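/- There exists a real constant C > 0 such that for every integer n ≥ 4 and every state (a,b,c,d) of positive integers on 4 vessels with a+b+c+d = n, the state (a,b,c,d) is p-pourable for some nonnegative integer p ≤ C·log₂ n·log₂ log₂ n. -/

import Mathlib

/-- A single pouring step between two vessels of a state on `k` vessels:
choose `i ≠ j` with `A i ≤ A j`, replace `A i` by `2 * A i` and `A j` by
`A j - A i`. -/
def PourStep {k : ℕ} (A B : Fin k → ℕ) : Prop :=
  ∃ i j : Fin k, i ≠ j ∧ A i ≤ A j ∧
    B = Function.update (Function.update A i (2 * A i)) j (A j - A i)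

/-- `PourSteps m A B` : the state `B` is reachable from `A` in exactly `m`
pouring steps. -/
def PourSteps {k : ℕ} : ℕ → (Fin k → ℕ) → (Fin k → ℕ) → Prop
  | 0, A, B => B = A
  | m + 1, A, B => ∃ C, PourStep A C ∧ PourSteps m C B

/-- A state is `p`-pourable if at most `p` pouring steps lead to a state
with an empty vessel. -/
def Pourable {k : ℕ} (p : ℕ) (A : Fin k → ℕ) : Prop :=
  ∃ m ≤ p, ∃ B : Fin k → ℕ, PourSteps m A B ∧ ∃ i, B i = 0

/-- `Tri m a b c a' b' c'`: up to reordering, at most `m` pouring steps lead from the three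
vessels `a, b, c` to the three vessels `a', b', c'`. -/
inductive Tri : ℕ → ℕ → ℕ → ℕ → ℕ → ℕ → ℕ → Prop
  | refl (m a b c : ℕ) : Tri m a b c a b c
  | rot {m a b c a' b' c' : ℕ} : Tri m b c a a' b' c' → Tri m a b c a' b' c'
  | swap {m a b c a' b' c' : ℕ} : Tri m b a c a' b' c' → Tri m a b c a' b' c'
  | pour {m a b c a' b' c' : ℕ} : a ≤ b → Tri m (2 * a) (b - a) c a' b' c' →
      Tri (m + 1) a b c a' b' c'

namespace Tri

theorem mono {m k a b c a' b' c' : ℕ} (h : Tri m a b c a' b' c') (hk : m ≤ k) :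
    Tri k a b c a' b' c' := by
  induction h generalizing k with
  | refl => exact refl ..
  | rot _ ih => exact rot (ih hk)
  | swap _ ih => exact swap (ih hk)
  | pour hab _ ih =>
    obtain ⟨k, rfl⟩ : ∃ l, k = l + 1 := ⟨k - 1, by omega⟩
    exact pour hab (ih (by omega))

theorem trans {m k a b c a' b' c' x y z : ℕ} (h : Tri m a b c a' b' c')
    (h' : Tri k a' b' c' x y z) : Tri (m + k) a b c x y z := by
  induction h with
  | refl => exact h'.mono (by omega)
  | rot _ ih => exact rot (ih h')
  | swap _ ih => exact swap (ih h')
  | @pour m _ _ _ _ _ _ hab _ ih => rw [Nat.add_right_comm]; exact pour hab (ih h')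

theorem sum_eq {m a b c a' b' c' : ℕ} (h : Tri m a b c a' b' c') :
    a' + b' + c' = a + b + c := by
  induction h <;> omega

theorem swap_right {m a b c a' b' c' : ℕ} (h : Tri m a c b a' b' c') :
    Tri m a b c a' b' c' :=
  rot (swap (rot (rot h)))

theorem exists_sorted (a b c : ℕ) :
    ∃ a' b' c', Tri 0 a b c a' b' c' ∧ a' ≤ b' ∧ b' ≤ c' ∧ a' ≤ a := by
  rcases le_total a b with hab | hab <;> rcases le_total b c with hbc | hbc <;>
    rcases le_total a c with hac | hac
  · exact ⟨a, b, c, refl .., hab, hbc, by omega⟩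
  · exact ⟨a, b, c, refl .., hab, hbc, by omega⟩
  · exact ⟨a, c, b, swap_right (refl ..), hac, hbc, by omega⟩
  · exact ⟨c, a, b, rot (rot (refl ..)), hac, hab, by omega⟩
  · exact ⟨b, a, c, swap (refl ..), hab, hac, by omega⟩
  · exact ⟨b, c, a, rot (refl ..), hbc, hac, by omega⟩
  · exact ⟨c, b, a, rot (swap (refl ..)), hbc, hab, by omega⟩
  · exact ⟨c, b, a, rot (swap (refl ..)), hbc, hab, by omega⟩

/-- Doubling `a` repeatedly, any multiple `q * a` can be removed from the second vessel, the
complementary multiple being taken from the third one. -/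
theorem multiply (i : ℕ) : ∀ {q q' : ℕ} (a r s : ℕ), q + q' + 1 = 2 ^ i →
    Tri i a (q * a + r) (q' * a + s) (2 ^ i * a) r s := by
  induction i with
  | zero =>
    intro q q' a r s h
    obtain ⟨rfl, rfl⟩ : q = 0 ∧ q' = 0 := by simpa using h
    simpa using refl 0 a r s
  | succ i ih =>
    intro q q' a r s h
    rw [pow_succ] at h
    rcases Nat.even_or_odd' q with ⟨u, rfl | rfl⟩
    · obtain ⟨v, rfl⟩ : ∃ v, q' = 2 * v + 1 := ⟨q' / 2, by omega⟩
      have := ih (q := u) (q' := v) (2 * a) r s (by omega)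
      refine swap_right (pour (by nlinarith) (swap_right ?_))
      convert this using 1
      · ring
      · rw [Nat.sub_eq_iff_eq_add (by nlinarith)]; ring
      · ring
    · obtain ⟨v, rfl⟩ : ∃ v, q' = 2 * v := ⟨q' / 2, by omega⟩
      have := ih (q := u) (q' := v) (2 * a) r s (by omega)
      refine pour (by nlinarith) ?_
      convert this using 1
      · rw [Nat.sub_eq_iff_eq_add (by nlinarith)]; ring
      · ring
      · ring

/-- Reduction of the middle vessel modulo the smallest one. -/
theorem exists_mod {k a b c : ℕ} (ha : 0 < a) (hbc : b ≤ c) (hk : b < 2 ^ k * a) :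
    ∃ y z, Tri k a b c (b % a) y z := by
  have hq : b / a < 2 ^ k := (Nat.div_lt_iff_lt_mul ha).2 hk
  obtain ⟨i, hik, hi, hi'⟩ : ∃ i ≤ k, b / a < 2 ^ i ∧ 2 ^ i ≤ 2 * (b / a) + 1 := by
    rcases Nat.eq_zero_or_pos (b / a) with h | h
    · exact ⟨0, by omega, by simp [h], by simp⟩
    · refine ⟨Nat.log 2 (b / a) + 1, ?_, Nat.lt_pow_succ_log_self (by norm_num) _, ?_⟩
      · exact Nat.log_lt_of_lt_pow h.ne' hq
      · have := Nat.pow_log_le_self 2 h.ne'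
        rw [pow_succ]; omega
  have hb := Nat.div_add_mod' b a
  have hle : (2 ^ i - 1 - b / a) * a ≤ b / a * a := Nat.mul_le_mul_right _ (by omega)
  have h := multiply i (q := b / a) (q' := 2 ^ i - 1 - b / a) a (b % a)
    (c - (2 ^ i - 1 - b / a) * a) (by omega)
  rw [hb, Nat.add_sub_cancel' (hle.trans (by omega))] at h
  exact ⟨_, _, (h.trans (rot (refl 0 _ _ _))).mono (by omega)⟩

/-- Reduction of the middle vessel to the distance to the next multiple of the smallest one. -/
theorem exists_sub_mod {k a b c : ℕ} (ha : 0 < a) (hbc : b ≤ c) (hk : b < 2 ^ k * a) :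
    ∃ y z, Tri (k + 1) a b c (a - b % a) y z := by
  have hq : b / a < 2 ^ k := (Nat.div_lt_iff_lt_mul ha).2 hk
  have hb := Nat.div_add_mod' b a
  have hmod := Nat.mod_lt b ha
  set q := b / a
  set i := Nat.log 2 (q + 1)
  have h1 : 2 ^ i ≤ q + 1 := Nat.pow_log_le_self 2 (Nat.succ_ne_zero q)
  have h2 : q + 1 < 2 ^ (i + 1) := Nat.lt_pow_succ_log_self (by norm_num) _
  have hik : i ≤ k := by
    by_contra! hlt
    have : 2 ^ (k + 1) ≤ 2 ^ i := Nat.pow_le_pow_right (by norm_num) hlt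
    rw [pow_succ] at this
    omega
  rw [pow_succ] at h2
  have hpos : 0 < 2 ^ i := by positivity
  obtain ⟨u, hu⟩ : ∃ u, q + 1 = 2 ^ i + u := ⟨q + 1 - 2 ^ i, by omega⟩
  obtain ⟨v, hv⟩ : ∃ v, u + v + 1 = 2 ^ i := ⟨2 ^ i - 1 - u, by omega⟩
  have hub : u * a ≤ q * a := Nat.mul_le_mul_right _ (by omega)
  have hvc : v * a ≤ q * a := Nat.mul_le_mul_right _ (by omega)
  have h := multiply i a (b - u * a) (c - v * a) hv
  rw [Nat.add_sub_cancel' (hub.trans (by omega)),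
    Nat.add_sub_cancel' (hvc.trans (by omega))] at h
  have e : q * a + a = 2 ^ i * a + u * a := by rw [← add_mul, ← hu]; ring
  have h' := h.trans (swap (pour (by omega) (swap (refl 0 _ _ _))))
  rw [show 2 ^ i * a - (b - u * a) = a - b % a by omega] at h'
  exact ⟨_, _, h'.mono (by omega)⟩

theorem exists_half {k a b c : ℕ} (ha : 0 < a) (hbc : b ≤ c) (hk : b < 2 ^ k * a) :
    ∃ x y z, Tri (k + 1) a b c x y z ∧ 2 * x ≤ a := by
  rcases le_total (2 * (b % a)) a with h | h
  · obtain ⟨y, z, hyz⟩ := exists_mod ha hbc hk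
    exact ⟨_, y, z, hyz.mono (by omega), h⟩
  · obtain ⟨y, z, hyz⟩ := exists_sub_mod ha hbc hk
    exact ⟨_, y, z, hyz, by omega⟩

theorem exists_small (h a b c : ℕ) :
    ∃ x y z, Tri (h * (h + 1)) a b c x y z ∧ x ≤ y ∧ y ≤ z ∧ 2 ^ h * x ≤ a + b + c := by
  have key : ∀ t, ∃ x y z, Tri (t * (h + 1)) a b c x y z ∧ x ≤ y ∧ y ≤ z ∧
      (2 ^ h * x ≤ a + b + c ∨ 2 ^ t * x ≤ a + b + c) := by
    intro t
    induction t with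
    | zero =>
      obtain ⟨x, y, z, hT, hxy, hyz, hxa⟩ := exists_sorted a b c
      exact ⟨x, y, z, hT.mono (by omega), hxy, hyz, Or.inr (by simp; omega)⟩
    | succ t ih =>
      obtain ⟨x, y, z, hT, hxy, hyz, hx⟩ := ih
      by_cases hh : 2 ^ h * x ≤ a + b + c
      · exact ⟨x, y, z, hT.mono (by nlinarith), hxy, hyz, Or.inl hh⟩
      have hs := hT.sum_eq
      obtain ⟨x', y', z', hT', hx'⟩ := exists_half (k := h) (a := x) (b := y) (c := z)
        (Nat.pos_of_ne_zero fun h0 => hh (by simp [h0])) hyz (by omega)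
      obtain ⟨u, v, w, hT'', huv, hvw, hu⟩ := exists_sorted x' y' z'
      refine ⟨u, v, w, ((hT.trans hT').trans hT'').mono (le_of_eq (by ring)), huv, hvw,
        Or.inr ?_⟩
      calc 2 ^ (t + 1) * u = 2 ^ t * (2 * u) := by ring
        _ ≤ 2 ^ t * x := Nat.mul_le_mul_left _ (by omega)
        _ ≤ a + b + c := hx.resolve_left hh
  obtain ⟨x, y, z, hT, hxy, hyz, hx⟩ := key h
  exact ⟨x, y, z, hT, hxy, hyz, hx.elim id id⟩

/-- Pouring from the odd vessel `c` into the even vessel `b` until `c` is the smaller one. -/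
theorem exists_odd_le {k a b c : ℕ} (hb : 0 < b) (hbe : Even b) (hc : Odd c)
    (hk : c < 2 ^ k * b) :
    ∃ y z, Tri k a b c a y z ∧ Odd z ∧ z ≤ y ∧ b ≤ y := by
  have hq : c / b < 2 ^ k := (Nat.div_lt_iff_lt_mul hb).2 hk
  have hdiv := Nat.div_add_mod' c b
  have hmod := Nat.mod_lt c hb
  set q := c / b
  set i := Nat.log 2 (q + 1)
  have h1 : 2 ^ i ≤ q + 1 := Nat.pow_log_le_self 2 (Nat.succ_ne_zero q)
  have h2 : q + 1 < 2 ^ (i + 1) := Nat.lt_pow_succ_log_self (by norm_num) _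
  have hik : i ≤ k := (Nat.pow_le_pow_iff_right (by norm_num)).1 (h1.trans hq)
  have hpos : 0 < 2 ^ i := by positivity
  obtain ⟨u, hu⟩ : ∃ u, u + 1 = 2 ^ i := ⟨2 ^ i - 1, by omega⟩
  have hle : u * b ≤ c := (Nat.mul_le_mul_right b (by omega : u ≤ q)).trans (by omega)
  have h := multiply i (q := u) (q' := 0) b (c - u * b) a (by omega)
  rw [Nat.add_sub_cancel' hle, zero_mul, zero_add] at h
  refine ⟨_, _, (rot (h.trans (rot (rot (refl 0 _ _ _))))).mono (by omega), ?_, ?_, ?_⟩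
  · exact Nat.Odd.sub_even hle hc (hbe.mul_left u)
  · have : (q + 1) * b ≤ (2 ^ i + u) * b := Nat.mul_le_mul_right b (by rw [pow_succ] at h2; omega)
    rw [add_mul, add_mul] at this
    omega
  · exact Nat.le_mul_of_pos_left b hpos

theorem exists_odd {k a b c : ℕ} (ha : 0 < a) (hab : a ≤ b) (hbc : b ≤ c)
    (hodd : Odd (a + b + c)) (hk : a + b + c < 2 ^ k * a) :
    ∃ x y z, Tri (2 * k) a b c x y z ∧ Odd x ∧ x ≤ a := by
  rcases Nat.even_or_odd a with hae | hao
  · obtain ⟨y, z, hT, hz, hzy⟩ : ∃ y z, Tri k a b c a y z ∧ Odd z ∧ z ≤ y := by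
      rcases Nat.even_or_odd b with hbe | hbo
      · have hc : Odd c := by
          rcases Nat.even_or_odd c with h | h
          · exact absurd ((hae.add hbe).add h) (Nat.not_even_iff_odd.2 hodd)
          · exact h
        have : 2 ^ k * a ≤ 2 ^ k * b := Nat.mul_le_mul_left _ hab
        obtain ⟨y, z, hT, hz, hzy, -⟩ := exists_odd_le (a := a) (by omega) hbe hc
          (by omega : c < 2 ^ k * b)
        exact ⟨y, z, hT, hz, hzy⟩
      · exact ⟨c, b, swap_right (refl ..), hbo, hbc⟩
    have hs := hT.sum_eq
    obtain ⟨u, v, hT'⟩ := exists_mod (k := k) ha hzy (by omega)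
    refine ⟨_, u, v, (hT.trans (swap_right hT')).mono (by omega), ?_, (Nat.mod_lt _ ha).le⟩
    rw [Nat.odd_iff] at hz ⊢
    rwa [Nat.mod_mod_of_dvd _ hae.two_dvd]
  · exact ⟨a, b, c, refl .., hao, le_rfl⟩

theorem exists_even {a b c : ℕ} (h : Even (a + b + c)) :
    ∃ x y z, Tri 1 a b c (2 * x) (2 * y) (2 * z) := by
  have key : ∀ {a b c : ℕ}, Even (a + b) → Even c →
      ∃ x y z, Tri 1 a b c (2 * x) (2 * y) (2 * z) := by
    intro a b c hab hc
    wlog hle : a ≤ b generalizing a b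
    · obtain ⟨x, y, z, hT⟩ := this (by rwa [add_comm]) (by omega)
      exact ⟨x, y, z, swap hT⟩
    obtain ⟨z, hz⟩ := hc.two_dvd
    obtain ⟨y, hy⟩ := hab.two_dvd
    refine ⟨a, y - a, z, pour hle ?_⟩
    rw [← hz, show 2 * (y - a) = b - a by omega]
    exact refl ..
  rcases Nat.even_or_odd c with hc | hc
  · exact key ((Nat.even_add.1 h).2 hc) hc
  · have hab : Odd (a + b) := by
      rw [← Nat.not_even_iff_odd] at hc ⊢
      exact fun h' => hc ((Nat.even_add.1 h).1 h')
    rcases Nat.even_or_odd a with ha | ha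
    · obtain ⟨x, y, z, hT⟩ := key (a := b) (b := c) (c := a) (by grind) ha
      exact ⟨x, y, z, rot hT⟩
    · obtain ⟨x, y, z, hT⟩ := key (a := c) (b := a) (c := b) (by grind) (by grind)
      exact ⟨x, y, z, rot (rot hT)⟩

/-- Pouring between two vessels whose sum is divisible by `2 ^ m`. -/
theorem exists_dvd {m b c : ℕ} (a : ℕ) (h : 2 ^ m ∣ b + c) :
    ∃ y z, Tri m a b c a y z ∧ 2 ^ m ∣ y ∧ 2 ^ m ∣ z := by
  suffices ∀ j ≤ m, ∃ y z, Tri j a b c a y z ∧ 2 ^ j ∣ y ∧ 2 ^ j ∣ z from this m le_rfl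
  intro j
  induction j with
  | zero => exact fun _ => ⟨b, c, refl .., by simp, by simp⟩
  | succ j ih =>
    intro hj
    obtain ⟨y, z, hT, hy, hz⟩ := ih (by omega)
    have hs : y + z = b + c := by have := hT.sum_eq; omega
    have hd : 2 ^ (j + 1) ∣ y + z := hs ▸ (pow_dvd_pow 2 hj).trans h
    have main : ∀ {y z : ℕ}, y ≤ z → 2 ^ j ∣ y → 2 ^ (j + 1) ∣ y + z →
        2 ^ (j + 1) ∣ 2 * y ∧ 2 ^ (j + 1) ∣ z - y := by
      intro y z hle hy hd
      have h2 : 2 ^ (j + 1) ∣ 2 * y := by rw [pow_succ']; exact mul_dvd_mul_left 2 hy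
      refine ⟨h2, ?_⟩
      rw [show z - y = (y + z) - 2 * y by omega]
      exact Nat.dvd_sub hd h2
    rcases le_total y z with hle | hle
    · obtain ⟨h1, h2⟩ := main hle hy hd
      exact ⟨_, _, hT.trans (rot (pour hle (rot (rot (refl 0 _ _ _))))), h1, h2⟩
    · obtain ⟨h1, h2⟩ := main hle hz (by rwa [add_comm z])
      exact ⟨_, _, hT.trans (swap_right (rot (pour hle (rot (rot (refl 0 _ _ _)))))), h1, h2⟩

end Tri

theorem Pourable.mono {k p q : ℕ} {A : Fin k → ℕ} (h : Pourable p A) (hpq : p ≤ q) :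
    Pourable q A := by
  obtain ⟨m, hm, hB⟩ := h
  exact ⟨m, hm.trans hpq, hB⟩

theorem PourStep.pourable {k p : ℕ} {A B : Fin k → ℕ} (h : PourStep A B) (hB : Pourable p B) :
    Pourable (p + 1) A := by
  obtain ⟨m, hm, D, hD, hi⟩ := hB
  exact ⟨m + 1, by omega, D, ⟨B, h, hD⟩, hi⟩

theorem PourStep.comp {k : ℕ} {A B : Fin k → ℕ} (h : PourStep A B) (σ : Equiv.Perm (Fin k)) :
    PourStep (A ∘ σ) (B ∘ σ) := by
  obtain ⟨i, j, hij, hle, rfl⟩ := h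
  refine ⟨σ.symm i, σ.symm j, by simpa using hij, by simpa using hle, ?_⟩
  simp [Function.update_comp_equiv]

theorem Pourable.comp {k p : ℕ} {A : Fin k → ℕ} (h : Pourable p A) (σ : Equiv.Perm (Fin k)) :
    Pourable p (A ∘ σ) := by
  obtain ⟨m, hm, B, hB, i, hi⟩ := h
  refine ⟨m, hm, B ∘ σ, ?_, σ.symm i, by simpa using hi⟩
  clear hm hi
  induction m generalizing A with
  | zero => exact congrArg (· ∘ σ) hB
  | succ m ih =>
    obtain ⟨D, hD, hB⟩ := hB
    exact ⟨D ∘ σ, hD.comp σ, ih hB⟩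

theorem Pourable.swap₀₁ {p a b c d : ℕ} (h : Pourable p ![b, a, c, d]) :
    Pourable p ![a, b, c, d] := by
  convert h.comp (Equiv.swap 0 1) using 1
  ext i; fin_cases i <;> rfl

theorem Pourable.swap₁₂ {p a b c d : ℕ} (h : Pourable p ![a, c, b, d]) :
    Pourable p ![a, b, c, d] := by
  convert h.comp (Equiv.swap 1 2) using 1
  ext i; fin_cases i <;> rfl

theorem Pourable.swap₂₃ {p a b c d : ℕ} (h : Pourable p ![a, b, d, c]) :
    Pourable p ![a, b, c, d] := by
  convert h.comp (Equiv.swap 2 3) using 1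
  ext i; fin_cases i <;> rfl

theorem Pourable.pour {p a b c d : ℕ} (hab : a ≤ b) (h : Pourable p ![2 * a, b - a, c, d]) :
    Pourable (p + 1) ![a, b, c, d] := by
  refine PourStep.pourable ⟨0, 1, by simp, hab, ?_⟩ h
  ext i; fin_cases i <;> rfl

theorem Pourable.of_zero {p b c d : ℕ} : Pourable p ![0, b, c, d] :=
  ⟨0, by omega, _, rfl, 0, rfl⟩

theorem Tri.pourable {m p a b c a' b' c' : ℕ} (h : Tri m a b c a' b' c') (G d : ℕ)
    (hp : Pourable p ![G * a', G * b', G * c', d]) :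
    Pourable (p + m) ![G * a, G * b, G * c, d] := by
  induction h with
  | refl => exact hp.mono (by omega)
  | rot _ ih => exact (ih hp).swap₁₂.swap₀₁
  | swap _ ih => exact (ih hp).swap₀₁
  | @pour m a b c a' b' c' hab _ ih =>
    refine Pourable.pour (Nat.mul_le_mul_left _ hab) ?_
    have := ih hp
    rwa [Nat.mul_sub, Nat.mul_left_comm] at this

/-- A multiple of an odd number completing `N` to a multiple of `2 ^ m`. -/
theorem exists_dvd_add_mul {x : ℕ} (hx : Odd x) (N m : ℕ) :
    ∃ q < 2 ^ m, 2 ^ m ∣ N + q * x := by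
  have hc : Nat.Coprime x (2 ^ m) := (Nat.coprime_two_right.2 hx).pow_right m
  have hpos : 0 < 2 ^ m := by positivity
  have : NeZero (2 ^ m) := ⟨hpos.ne'⟩
  refine ⟨(-(N : ZMod (2 ^ m)) * (x : ZMod (2 ^ m))⁻¹).val, ZMod.val_lt _, ?_⟩
  rw [← ZMod.natCast_eq_zero_iff]
  push_cast
  rw [ZMod.natCast_zmod_val, mul_assoc, mul_comm _ (x : ZMod (2 ^ m)),
    ZMod.coe_mul_inv_eq_one x hc]
  ring

/-- With a small odd vessel `x`, the first three vessels can be made divisible by `2 ^ m` while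
only little is taken from the fourth one. -/
theorem exists_pourable_pow_mul {m G x y z d : ℕ} (hx : Odd x) (h4 : 4 * (2 ^ m * x) ≤ x + y + z)
    (hd : G * (2 ^ m * x) ≤ d) :
    ∃ x' y' z' d', G * (2 ^ m * (x' + y' + z')) + d' = G * (x + y + z) + d ∧
      d ≤ d' + G * (2 ^ m * x) ∧
      ∀ p, Pourable p ![G * 2 ^ m * x', G * 2 ^ m * y', G * 2 ^ m * z', d'] →
        Pourable (p + 2 * m) ![G * x, G * y, G * z, d] := by
  wlog hzy : z ≤ y generalizing y z
  · obtain ⟨x', y', z', d', hs, hd', hp⟩ := this (y := z) (z := y) (by omega) (by omega)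
    exact ⟨x', y', z', d', by rw [hs]; ring, hd', fun p h => (hp p h).swap₁₂⟩
  have hpos : 0 < 2 ^ m := by positivity
  obtain ⟨q, hq, hdvd⟩ := exists_dvd_add_mul hx (x + y + z) m
  obtain ⟨q', hq'⟩ : ∃ q', q + q' + 1 = 2 ^ m := ⟨2 ^ m - 1 - q, by omega⟩
  have hqx : q * x ≤ 2 ^ m * x := Nat.mul_le_mul_right _ (by omega)
  have hqx' : q' * x ≤ 2 ^ m * x := Nat.mul_le_mul_right _ (by omega)
  have hx1 : 1 * x ≤ 2 ^ m * x := Nat.mul_le_mul_right _ hpos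
  have hmx : 2 ^ m * x = q * x + q' * x + x := by rw [← hq']; ring
  obtain ⟨y₁, rfl⟩ : ∃ y₁, y = q' * x + y₁ := ⟨y - q' * x, by omega⟩
  have hqG : q * (G * x) ≤ G * (2 ^ m * x) := by nlinarith
  obtain ⟨d', rfl⟩ : ∃ d', d = q * (G * x) + d' := ⟨d - q * (G * x), by omega⟩
  have hyz : 2 ^ m ∣ y₁ + z := by
    have h2 : 2 ^ m ∣ 2 ^ m * x := dvd_mul_right _ _
    rw [show x + (q' * x + y₁) + z + q * x = 2 ^ m * x + (y₁ + z) by omega] at hdvd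
    exact (Nat.dvd_add_right h2).1 hdvd
  obtain ⟨_, _, hT, ⟨y', rfl⟩, z', rfl⟩ := Tri.exists_dvd (2 ^ m * x) hyz
  have hs := hT.sum_eq
  refine ⟨x, y', z', d', ?_, by omega, fun p hp => ?_⟩
  · have : 2 ^ m * (x + y' + z') = 2 ^ m * x + (y₁ + z) := by rw [mul_add, mul_add]; omega
    rw [this, hmx]; ring
  · have h1 := hT.pourable (p := p) G d' (by simpa only [mul_assoc] using hp)
    have h2 := Tri.multiply m (G * x) d' (G * y₁) hq'
    have h3 := h2.pourable (p := p + m) 1 (G * z) (by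
      simp only [one_mul]
      rw [Nat.mul_left_comm]
      exact h1.swap₂₃.swap₁₂)
    simp only [one_mul] at h3
    rw [two_mul, ← add_assoc, mul_add G, Nat.mul_left_comm G q']
    exact h3.swap₁₂.swap₂₃

theorem pourable_of_pow_dvd {n L K : ℕ} (hn : n < 2 ^ (L + 1)) (hK : 4 * (L + 1) ≤ 2 ^ K) (r : ℕ) :
    ∀ g a b c d : ℕ, L + 1 ≤ g + r → 2 ^ g * (a + b + c) + d = n →
      2 ^ K * n ≤ 4 * (2 ^ K * d) + 4 * (g * n) →
      Pourable (14 * K * r + 2 * K * (2 * K + 1)) ![2 ^ g * a, 2 ^ g * b, 2 ^ g * c, d] := by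
  have hK2 : 2 ≤ K := by
    by_contra! h
    have : 2 ^ K ≤ 2 ^ 1 := Nat.pow_le_pow_right (by norm_num) (by omega)
    omega
  induction r using Nat.strong_induction_on with
  | _ r ih =>
  intro g a b c d hr hsum hd
  by_cases hg : L + 1 ≤ g
  · have h1 : 2 ^ (L + 1) ≤ 2 ^ g := Nat.pow_le_pow_right (by norm_num) hg
    have h2 : a + b + c = 0 := by
      by_contra h0
      have : 2 ^ g * 1 ≤ 2 ^ g * (a + b + c) := Nat.mul_le_mul_left _ (by omega)
      omega
    obtain rfl : a = 0 := by omega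
    exact Pourable.of_zero
  have hnd : n ≤ 2 ^ K * d := by
    have h1 : 4 * (L + 1) * n ≤ 2 ^ K * n := Nat.mul_le_mul_right _ hK
    have h2 : (g + 1) * n ≤ (L + 1) * n := Nat.mul_le_mul_right _ (by omega)
    rw [add_mul, one_mul] at h2
    rw [mul_assoc] at h1
    omega
  rcases Nat.even_or_odd (a + b + c) with he | ho
  · obtain ⟨x, y, z, hT⟩ := Tri.exists_even he
    have hs := hT.sum_eq
    have h := ih (r - 1) (by omega) (g + 1) x y z d (by omega)
      (by rw [← hsum, ← hs]; ring) (by rw [add_mul]; omega)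
    refine (hT.pourable (2 ^ g) d (by simpa only [pow_succ, mul_assoc] using h)).mono ?_
    obtain ⟨r, rfl⟩ : ∃ t, r = t + 1 := ⟨r - 1, by omega⟩
    simp only [Nat.add_sub_cancel]
    nlinarith
  obtain ⟨x, y, z, hT, hxy, hyz, hx⟩ := Tri.exists_small (2 * K) a b c
  have hs := hT.sum_eq
  rcases Nat.eq_zero_or_pos x with rfl | hx0
  · exact (hT.pourable (2 ^ g) d (p := 0) (by simpa using Pourable.of_zero)).mono (by omega)
  rw [← hs] at hx hsum ho
  set N := x + y + z with hN
  set k := Nat.log 2 (N / x) with hk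
  have hNx : 2 ^ (2 * K) ≤ N / x := (Nat.le_div_iff_mul_le hx0).2 hx
  have hNx0 : N / x ≠ 0 := (lt_of_lt_of_le (by positivity) hNx).ne'
  have hKk : 2 * K ≤ k := Nat.le_log_of_pow_le (by norm_num) hNx
  have hkN : 2 ^ k * x ≤ N := (Nat.le_div_iff_mul_le hx0).1 (Nat.pow_log_le_self 2 hNx0)
  have hNk : N < 2 ^ (k + 1) * x :=
    (Nat.div_lt_iff_lt_mul hx0).1 (Nat.lt_pow_succ_log_self (by norm_num) _)
  have hkL : g + k < L + 1 := by
    refine (Nat.pow_lt_pow_iff_right (a := 2) (by norm_num)).1 ?_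
    calc 2 ^ (g + k) ≤ 2 ^ g * (2 ^ k * x) := by
          rw [pow_add]; exact Nat.mul_le_mul_left _ (Nat.le_mul_of_pos_right _ hx0)
      _ ≤ 2 ^ g * N := Nat.mul_le_mul_left _ hkN
      _ < 2 ^ (L + 1) := by omega
  obtain ⟨w, u, v, hT', hw, hwx⟩ := Tri.exists_odd hx0 hxy hyz ho hNk
  have hs' := hT'.sum_eq
  obtain ⟨m, hm⟩ : ∃ m, k = K + m := ⟨k - K, by omega⟩
  have hwN : 2 ^ K * (2 ^ m * w) ≤ N := by
    rw [← mul_assoc, ← pow_add, ← hm]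
    exact (Nat.mul_le_mul_left _ hwx).trans hkN
  have hwn : 2 ^ K * (2 ^ g * (2 ^ m * w)) ≤ n := by
    rw [Nat.mul_left_comm]
    exact (Nat.mul_le_mul_left _ hwN).trans (by omega)
  obtain ⟨x', y', z', d', hsum', hd', hp⟩ :=
    exists_pourable_pow_mul (G := 2 ^ g) (x := w) (y := u) (z := v) (d := d) (m := m) hw
      (by rw [hs']; exact (Nat.mul_le_mul_right _ (by omega)).trans hwN)
      (Nat.le_of_mul_le_mul_left (hwn.trans hnd) (by positivity))
  have h := ih (r - m) (by omega) (g + m) x' y' z' d' (by omega)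
    (by rw [pow_add, mul_assoc, hsum', hs']; exact hsum) (by
      have h1 : 2 ^ K * d ≤ 2 ^ K * d' + 2 ^ K * (2 ^ g * (2 ^ m * w)) := by
        rw [← mul_add]; exact Nat.mul_le_mul_left _ hd'
      have h2 : 1 * n ≤ m * n := Nat.mul_le_mul_right _ (by omega)
      rw [add_mul]
      omega)
  rw [pow_add] at h
  refine (hT.pourable (2 ^ g) d (hT'.pourable (2 ^ g) d (hp _ h))).mono ?_
  obtain ⟨t, rfl⟩ : ∃ t, r = t + m := ⟨r - m, by omega⟩
  rw [Nat.add_sub_cancel, hm]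
  have : K * K ≤ K * m := Nat.mul_le_mul_left _ (by omega)
  have : 2 * m ≤ K * m := Nat.mul_le_mul_right _ hK2
  nlinarith

theorem pourable_of_le {a b c d n : ℕ} (hn : a + b + c + d = n)
    (had : a ≤ d) (hbd : b ≤ d) (hcd : c ≤ d) {K : ℕ} (hK : 4 * (Nat.log 2 n + 1) ≤ 2 ^ K) :
    Pourable (14 * K * (Nat.log 2 n + 1) + 2 * K * (2 * K + 1)) ![a, b, c, d] := by
  have h := pourable_of_pow_dvd (Nat.lt_pow_succ_log_self (by norm_num) n) hK
    (Nat.log 2 n + 1) 0 a b c d (by omega) (by simpa using hn) (by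
      have : 2 ^ K * n ≤ 2 ^ K * (4 * d) := Nat.mul_le_mul_left _ (by omega)
      rw [Nat.mul_left_comm] at this
      omega)
  simpa using h

theorem pourable_of_sum_eq {a b c d n : ℕ} (hn : a + b + c + d = n) {K : ℕ}
    (hK : 4 * (Nat.log 2 n + 1) ≤ 2 ^ K) :
    Pourable (14 * K * (Nat.log 2 n + 1) + 2 * K * (2 * K + 1)) ![a, b, c, d] := by
  by_cases hd : a ≤ d ∧ b ≤ d ∧ c ≤ d
  · exact pourable_of_le hn hd.1 hd.2.1 hd.2.2 hK
  by_cases hc : a ≤ c ∧ b ≤ c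
  · exact (pourable_of_le (a := a) (b := b) (c := d) (d := c) (by omega) hc.1 hc.2
      (by omega) hK).swap₂₃
  by_cases hb : a ≤ b
  · exact (pourable_of_le (a := a) (b := c) (c := d) (d := b) (by omega) hb
      (by omega) (by omega) hK).swap₂₃.swap₁₂
  · exact (pourable_of_le (a := b) (b := c) (c := d) (d := a) (by omega) (by omega)
      (by omega) (by omega) hK).swap₂₃.swap₁₂.swap₀₁

theorem stmt19 :
    ∃ C : ℝ, 0 < C ∧ ∀ n : ℕ, 4 ≤ n → ∀ a b c d : ℕ,
      0 < a → 0 < b → 0 < c → 0 < d → a + b + c + d = n →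
      ∃ p : ℕ, (p : ℝ) ≤ C * Real.logb 2 n * Real.logb 2 (Real.logb 2 n) ∧
        Pourable p ![a, b, c, d] := by
  refine ⟨200, by norm_num, fun n hn a b c d _ _ _ _ hsum => ?_⟩
  set L := Nat.log 2 n
  set K := Nat.log 2 L + 3
  have hL : 2 ≤ L := Nat.le_log_of_pow_le (by norm_num) hn
  have hLK : 4 * (L + 1) ≤ 2 ^ K := by
    have : L < 2 ^ (Nat.log 2 L + 1) := Nat.lt_pow_succ_log_self (by norm_num) L
    rw [show K = Nat.log 2 L + 1 + 2 from rfl, pow_add]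
    omega
  refine ⟨_, ?_, pourable_of_sum_eq hsum hLK⟩
  have hl : (L : ℝ) ≤ Real.logb 2 n := by
    simpa using Real.natLog_le_logb n 2
  have hL' : (2 : ℝ) ≤ L := by exact_mod_cast hL
  have hll : ((Nat.log 2 L : ℕ) : ℝ) ≤ Real.logb 2 (Real.logb 2 n) := by
    have h1 : ((Nat.log 2 L : ℕ) : ℝ) ≤ Real.logb 2 L := by simpa using Real.natLog_le_logb L 2
    exact h1.trans (Real.logb_le_logb_of_le (by norm_num) (by linarith) hl)
  have hll1 : (1 : ℝ) ≤ ((Nat.log 2 L : ℕ) : ℝ) := by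
    exact_mod_cast Nat.le_log_of_pow_le (by norm_num) (by simpa using hL)
  have hKL : (K : ℝ) ≤ L + 2 := by
    have : Nat.log 2 L < L := Nat.log_lt_self 2 (by omega)
    exact_mod_cast (by omega : K ≤ L + 2)
  have hK : (K : ℝ) ≤ 4 * Real.logb 2 (Real.logb 2 n) := by
    have : (K : ℝ) = (Nat.log 2 L : ℕ) + 3 := by simp [K]
    linarith
  calc ((14 * K * (L + 1) + 2 * K * (2 * K + 1) : ℕ) : ℝ)
      = K * (14 * (L + 1) + 2 * (2 * K + 1)) := by push_cast; ring
    _ ≤ (4 * Real.logb 2 (Real.logb 2 n)) * (50 * Real.logb 2 n) := by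
        refine mul_le_mul hK (by linarith) (by positivity) (by linarith)
    _ = 200 * Real.logb 2 n * Real.logb 2 (Real.logb 2 n) := by ring
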